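/- Let μ ∈ ℝ with μ ∉ {−1,−2,−3,…}, let ν ∈ ℝ and j ∈ ℕ₀. Then, as x → 0⁺: (a) Λ_{1,j}^{μ,ν}(x) → ((μ+ν+2)/2)_j/(j!·Γ((μ+2)/2)·Γ((ν+2)/2)); (b) if ν > 0 then x^ν·Λ_{2,j}^{μ,ν}(x) → ((μ−ν+2)/2)_j·2^{ν−1}·Γ(ν/2)/(j!·Γ((μ+2)/2)); (c) if ν = 0 then Λ_{2,j}^{μ,0}(x)/(−log(x/2)) → ((μ+2)/2)_j/(j!·Γ((μ+2)/2)); (d) if ν < 0 then Λ_{2,j}^{μ,ν}(x) → ((μ+ν+2)/2)_j·Γ(−ν/2)/(2·j!·Γ((μ+2)/2)). -/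

import Mathlib

noncomputable section

open Set MeasureTheory Filter Topology

/-- The Euler operator `θ = x·d/dx` acting on real-valued functions on `ℝ`. -/
def eulerOp (u : ℝ → ℝ) : ℝ → ℝ := fun x => x * deriv u x

/-- The operator `(θ + a)(θ + b) − x²` applied to `v`. -/
def quadOp (a b : ℝ) (v : ℝ → ℝ) : ℝ → ℝ := fun x =>
  eulerOp (fun y => eulerOp v y + b * v y) x
    + a * (eulerOp v x + b * v x) - x ^ 2 * v x

/-- The fourth-order operator `D_{μ,ν} = x⁻²((θ+μ+ν)(θ+μ) − x²)(θ(θ+ν) − x²)`. -/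
def Dop (μ ν : ℝ) (u : ℝ → ℝ) : ℝ → ℝ := fun x =>
  quadOp (μ + ν) μ (quadOp 0 ν u) x / x ^ 2

/-- The normalized I-Bessel function `Ĩ_α(z) = Σ (z/2)^{2n}/(n!·Γ(n+α+1))`. -/
def tildeI (α z : ℝ) : ℝ :=
  ∑' n : ℕ, (z / 2) ^ (2 * n) / ((n.factorial : ℝ) * Real.Gamma ((n : ℝ) + α + 1))

/-- The K-Bessel function `K_α(z) = ∫₀^∞ e^{−z·cosh s}·cosh(α·s) ds`. -/
def besselK (α z : ℝ) : ℝ :=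
  ∫ s in Ioi (0 : ℝ), Real.exp (-z * Real.cosh s) * Real.cosh (α * s)

/-- The normalized K-Bessel function `K̃_α(z) = (z/2)^{−α}·K_α(z)`. -/
def tildeK (α z : ℝ) : ℝ := (z / 2) ^ (-α) * besselK α z

/-- The generating function `G₁^{μ,ν}(t,x)`. -/
def genG₁ (μ ν t x : ℝ) : ℝ :=
  (1 - t) ^ (-(μ + ν + 2) / 2) * tildeI (μ / 2) (t * x / (1 - t)) * tildeI (ν / 2) (x / (1 - t))

/-- The generating function `G₂^{μ,ν}(t,x)`. -/
def genG₂ (μ ν t x : ℝ) : ℝ :=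
  (1 - t) ^ (-(μ + ν + 2) / 2) * tildeI (μ / 2) (t * x / (1 - t)) * tildeK (ν / 2) (x / (1 - t))

/-- The generating function `G₃^{μ,ν}(t,x)`. -/
def genG₃ (μ ν t x : ℝ) : ℝ :=
  (1 - t) ^ (-(μ + ν + 2) / 2) * tildeK (μ / 2) (t * x / (1 - t)) * tildeI (ν / 2) (x / (1 - t))

/-- The generating function `G₄^{μ,ν}(t,x)`. -/
def genG₄ (μ ν t x : ℝ) : ℝ :=
  (1 - t) ^ (-(μ + ν + 2) / 2) * tildeK (μ / 2) (t * x / (1 - t)) * tildeK (ν / 2) (x / (1 - t))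

/-- `Λ₁ⱼ^{μ,ν}(x) = (1/j!)·(∂/∂t)^j|₀ G₁^{μ,ν}(t,x)`. -/
def Lambda₁ (μ ν : ℝ) (j : ℕ) (x : ℝ) : ℝ :=
  iteratedDeriv j (fun t => genG₁ μ ν t x) 0 / (j.factorial : ℝ)

/-- `Λ₂ⱼ^{μ,ν}(x) = (1/j!)·(∂/∂t)^j|₀ G₂^{μ,ν}(t,x)`. -/
def Lambda₂ (μ ν : ℝ) (j : ℕ) (x : ℝ) : ℝ :=
  iteratedDeriv j (fun t => genG₂ μ ν t x) 0 / (j.factorial : ℝ)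

/-- `Λ₁ⱼ` for integer `j`, vanishing for `j < 0`. -/
def Lambda₁Z (μ ν : ℝ) (j : ℤ) (x : ℝ) : ℝ :=
  if 0 ≤ j then Lambda₁ μ ν j.toNat x else 0

/-- `Λ₂ⱼ` for integer `j`, vanishing for `j < 0`. -/
def Lambda₂Z (μ ν : ℝ) (j : ℤ) (x : ℝ) : ℝ :=
  if 0 ≤ j then Lambda₂ μ ν j.toNat x else 0

/-- For `μ = m` a positive odd integer, `Λ₃ⱼ^{μ,ν}(x) = (1/(j+μ)!)·(∂/∂t)^{j+μ}|₀ [tᵐ·G₃]`,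
the derivative at `0` being the limit from the right of the `(j+μ)`-th derivative of the
real-analytic function `t ↦ tᵐ·G₃^{m,ν}(t,x)` on `(0,1)`; it vanishes for `j < −μ`. -/
def Lambda₃ (m : ℕ) (ν : ℝ) (j : ℤ) (x : ℝ) : ℝ :=
  if -(m : ℤ) ≤ j then
    limUnder (𝓝[>] (0 : ℝ))
        (fun t => iteratedDeriv (j + (m : ℤ)).toNat (fun s => s ^ m * genG₃ (m : ℝ) ν s x) t) /
      (((j + (m : ℤ)).toNat.factorial : ℝ))
  else 0

/-- For `μ = m` a positive odd integer, `Λ₄ⱼ^{μ,ν}(x) = (1/(j+μ)!)·(∂/∂t)^{j+μ}|₀ [tᵐ·G₄]`,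
vanishing for `j < −μ`. -/
def Lambda₄ (m : ℕ) (ν : ℝ) (j : ℤ) (x : ℝ) : ℝ :=
  if -(m : ℤ) ≤ j then
    limUnder (𝓝[>] (0 : ℝ))
        (fun t => iteratedDeriv (j + (m : ℤ)).toNat (fun s => s ^ m * genG₄ (m : ℝ) ν s x) t) /
      (((j + (m : ℤ)).toNat.factorial : ℝ))
  else 0

/-- The Pochhammer symbol `(a)ₙ = a(a+1)⋯(a+n−1)`. -/
def poch (a : ℝ) (n : ℕ) : ℝ := (ascPochhammer ℝ n).eval a

open scoped ContDiff Nat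

/-! ### Pochhammer symbols as derivatives of powers of `1 - t` -/

lemma poch_succ (b : ℝ) (n : ℕ) : poch b (n + 1) = poch b n * (b + n) := by
  simp [poch, ascPochhammer_succ_right]

lemma contDiffOn_one_sub_rpow (a : ℝ) :
    ContDiffOn ℝ ∞ (fun t : ℝ => (1 - t) ^ a) (Iio 1) := fun _ ht =>
  ((contDiffAt_const.sub contDiffAt_id).rpow_const_of_ne
    (sub_pos.2 (mem_Iio.1 ht)).ne').contDiffWithinAt

lemma iteratedDeriv_one_sub_rpow_neg (b : ℝ) (n : ℕ) {t : ℝ} (ht : t < 1) :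
    iteratedDeriv n (fun s : ℝ => (1 - s) ^ (-b)) t = poch b n * (1 - t) ^ (-b - n) := by
  induction n generalizing t with
  | zero => simp [poch]
  | succ n ih =>
    have hpos : 0 < 1 - t := by linarith
    have heq : iteratedDeriv n (fun s : ℝ => (1 - s) ^ (-b)) =ᶠ[𝓝 t]
        fun s => poch b n * (1 - s) ^ (-b - n) := by
      filter_upwards [Iio_mem_nhds ht] with s hs using ih hs
    rw [iteratedDeriv_succ, heq.deriv_eq]
    have h := ((((hasDerivAt_id t).const_sub 1).rpow_const (p := -b - n)
      (Or.inl hpos.ne')).const_mul (poch b n)).deriv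
    simp only [id] at h
    rw [h, poch_succ, show -b - (n : ℝ) - 1 = -b - ((n + 1 : ℕ) : ℝ) by push_cast; ring]
    ring

/-! ### Families depending smoothly on a parameter -/

lemma contDiffOn_iteratedDeriv_param {F : ℝ → ℝ → ℝ} {U : Set ℝ} (hU : IsOpen U)
    (hF : ContDiffOn ℝ ∞ (fun p : ℝ × ℝ => F p.1 p.2) (univ ×ˢ U)) (n : ℕ) :
    ContDiffOn ℝ ∞ (fun p : ℝ × ℝ => iteratedDeriv n (F p.1) p.2) (univ ×ˢ U) := by
  have hopen : IsOpen ((univ : Set ℝ) ×ˢ U) := isOpen_univ.prod hU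
  induction n with
  | zero => simpa using hF
  | succ n ih =>
    have h1 := (ih.fderiv_of_isOpen (m := ∞) hopen (by simp)).clm_apply
      (contDiffOn_const (c := ((0 : ℝ), (1 : ℝ))))
    refine h1.congr fun p hp => ?_
    have hd : HasFDerivAt (fun p : ℝ × ℝ => iteratedDeriv n (F p.1) p.2) _ (p.1, p.2) :=
      ((ih.contDiffAt (hopen.mem_nhds hp)).differentiableAt (by simp)).hasFDerivAt
    have hline : HasDerivAt (fun t : ℝ => (p.1, t)) ((0 : ℝ), (1 : ℝ)) p.2 :=
      (hasDerivAt_const p.2 p.1).prodMk (hasDerivAt_id p.2)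
    rw [iteratedDeriv_succ]
    exact (hd.comp_hasDerivAt p.2 hline).deriv

lemma tendsto_iteratedDeriv_param {F : ℝ → ℝ → ℝ} {U : Set ℝ} (hU : IsOpen U)
    (hF : ContDiffOn ℝ ∞ (fun p : ℝ × ℝ => F p.1 p.2) (univ ×ˢ U)) (n : ℕ) (x : ℝ) {t : ℝ}
    (ht : t ∈ U) :
    Tendsto (fun y => iteratedDeriv n (F y) t) (𝓝 x) (𝓝 (iteratedDeriv n (F x) t)) := by
  have h := (contDiffOn_iteratedDeriv_param hU hF n).continuousOn.continuousAt
    ((isOpen_univ.prod hU).mem_nhds (mk_mem_prod (mem_univ x) ht))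
  exact ContinuousAt.tendsto <|
    ContinuousAt.comp (f := fun y : ℝ => (y, t)) h (by fun_prop)

lemma contDiffOn_section {F : ℝ → ℝ → ℝ} {U : Set ℝ}
    (hF : ContDiffOn ℝ ∞ (fun p : ℝ × ℝ => F p.1 p.2) (univ ×ˢ U)) (x : ℝ) :
    ContDiffOn ℝ ∞ (F x) U :=
  hF.comp (contDiff_prodMk_right x).contDiffOn fun _ ht => mk_mem_prod (mem_univ x) ht

/-! ### The normalized `I`-Bessel function -/

lemma contDiff_tildeI (α : ℝ) : ContDiff ℝ ∞ (tildeI α) := by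
  set c : ℕ → ℝ := fun n => 1 / ((n ! : ℝ) * Real.Gamma (n + α + 1)) with hc
  have hlarge : ∀ᶠ n : ℕ in atTop, 0 < (n : ℝ) + α + 1 := by
    filter_upwards [eventually_gt_atTop ⌈-α - 1⌉₊] with n hn
    have := (Nat.le_ceil (-α - 1)).trans_lt (Nat.cast_lt (α := ℝ).2 hn)
    linarith
  have hne : ∀ᶠ n in atTop, c n ≠ 0 := by
    filter_upwards [hlarge] with n hn
    have := Real.Gamma_pos_of_pos hn
    have := Nat.cast_pos (α := ℝ).2 n.factorial_pos
    positivity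
  have hratio : Tendsto (fun n => ‖c n.succ‖ / ‖c n‖) atTop (𝓝 0) := by
    have h1 : Tendsto (fun n : ℕ => 1 / ((n : ℝ) + 1)) atTop (𝓝 0) :=
      tendsto_one_div_add_atTop_nhds_zero_nat
    have h2 : Tendsto (fun n : ℕ => ((n : ℝ) + α + 1)⁻¹) atTop (𝓝 0) := by
      refine tendsto_inv_atTop_zero.comp ?_
      simp only [add_assoc]
      exact tendsto_atTop_add_const_right _ _ tendsto_natCast_atTop_atTop
    refine Tendsto.congr' ?_ (by simpa using h1.mul h2)
    filter_upwards [hlarge] with n hn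
    have hG := Real.Gamma_pos_of_pos hn
    have hf := Nat.cast_pos (α := ℝ).2 n.factorial_pos
    have hstep : Real.Gamma ((n : ℝ) + 1 + α + 1)
        = (n + α + 1) * Real.Gamma (n + α + 1) := by
      rw [← Real.Gamma_add_one hn.ne']; ring_nf
    have hn1 : (0 : ℝ) < n + 1 := by positivity
    simp only [hc, Nat.succ_eq_add_one, Nat.factorial_succ, Nat.cast_mul, Nat.cast_add,
      Nat.cast_one, hstep]
    rw [Real.norm_of_nonneg (by positivity), Real.norm_of_nonneg (by positivity)]
    field_simp
  have hrad := FormalMultilinearSeries.ofScalars_radius_eq_top_of_tendsto ℝ c hne hratio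
  have hser := (FormalMultilinearSeries.ofScalars ℝ c).hasFPowerSeriesOnBall
    (by rw [hrad]; exact ENNReal.zero_lt_top)
  have hA : ContDiff ℝ ∞ (FormalMultilinearSeries.ofScalars ℝ c).sum := by
    refine contDiff_iff_contDiffAt.2 fun w => (hser.analyticAt_of_mem ?_).contDiffAt
    rw [hrad]; simp
  have heq : tildeI α = fun z => (FormalMultilinearSeries.ofScalars ℝ c).sum ((z / 2) ^ 2) := by
    funext z
    rw [tildeI, FormalMultilinearSeries.sum]
    refine tsum_congr fun n => ?_
    rw [FormalMultilinearSeries.ofScalars_apply_eq, smul_eq_mul, ← pow_mul]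
    simp only [hc]; ring
  rw [heq]
  exact hA.comp ((contDiff_id.div_const 2).pow 2)

lemma tildeI_zero (α : ℝ) : tildeI α 0 = 1 / Real.Gamma (α + 1) := by
  rw [tildeI, tsum_eq_single 0 fun n hn => by simp [hn]]
  simp

lemma contDiffOn_tildeI_div_one_sub (α : ℝ) {g : ℝ × ℝ → ℝ} (hg : ContDiff ℝ ∞ g) :
    ContDiffOn ℝ ∞ (fun p : ℝ × ℝ => tildeI α (g p / (1 - p.2))) (univ ×ˢ Iio 1) :=
  (contDiff_tildeI α).comp_contDiffOn <| hg.contDiffOn.div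
    (contDiff_const.sub contDiff_snd).contDiffOn fun _ hp => (sub_pos.2 (mem_Iio.1 hp.2)).ne'

lemma contDiffOn_rpow_mul_tildeI (a α : ℝ) :
    ContDiffOn ℝ ∞ (fun p : ℝ × ℝ => (1 - p.2) ^ a * tildeI α (p.2 * p.1 / (1 - p.2)))
      (univ ×ˢ Iio 1) :=
  ((contDiffOn_one_sub_rpow a).comp contDiff_snd.contDiffOn fun _ hp => hp.2).mul
    (contDiffOn_tildeI_div_one_sub α (contDiff_snd.mul contDiff_fst))

lemma iteratedDeriv_rpow_mul_const (b c : ℝ) (n : ℕ) :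
    iteratedDeriv n (fun t : ℝ => (1 - t) ^ (-b) * c) 0 = poch b n * c := by
  rw [iteratedDeriv_mul_const_field, iteratedDeriv_one_sub_rpow_neg b n one_pos]
  simp

lemma tendsto_Lambda₁ (μ ν : ℝ) (j : ℕ) :
    Tendsto (fun x => Lambda₁ μ ν j x) (𝓝[>] (0 : ℝ))
      (𝓝 (poch ((μ + ν + 2) / 2) j /
        ((j.factorial : ℝ) * Real.Gamma ((μ + 2) / 2) * Real.Gamma ((ν + 2) / 2)))) := by
  have hG : ContDiffOn ℝ ∞ (fun p : ℝ × ℝ => genG₁ μ ν p.2 p.1) (univ ×ˢ Iio 1) :=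
    (contDiffOn_rpow_mul_tildeI _ _).mul (contDiffOn_tildeI_div_one_sub _ contDiff_fst)
  have h := (tendsto_iteratedDeriv_param (F := fun x t => genG₁ μ ν t x) isOpen_Iio hG j 0
    (t := 0) (by simp)).div_const (j ! : ℝ)
  have h0 : (fun t => genG₁ μ ν t 0) = fun t : ℝ => (1 - t) ^ (-((μ + ν + 2) / 2)) *
      (1 / Real.Gamma ((μ + 2) / 2) * (1 / Real.Gamma ((ν + 2) / 2))) := by
    funext t
    simp only [genG₁, mul_zero, zero_div, tildeI_zero]
    rw [show μ / 2 + 1 = (μ + 2) / 2 by ring, show ν / 2 + 1 = (ν + 2) / 2 by ring, neg_div,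
      mul_assoc]
  rw [h0, iteratedDeriv_rpow_mul_const] at h
  have hval : poch ((μ + ν + 2) / 2) j /
      ((j ! : ℝ) * Real.Gamma ((μ + 2) / 2) * Real.Gamma ((ν + 2) / 2)) =
      poch ((μ + ν + 2) / 2) j *
        (1 / Real.Gamma ((μ + 2) / 2) * (1 / Real.Gamma ((ν + 2) / 2))) / j ! := by
    simp only [div_eq_mul_inv, mul_inv]
    ring
  rw [hval]
  exact h.mono_left nhdsWithin_le_nhds


/-! ### Bessel moments -/

/-- The integrand `(y/u)ᵏ·e^{−u−y/u}·u^{β−1}` of a Bessel moment. -/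
def besselIntegrand (β : ℝ) (k : ℕ) (y u : ℝ) : ℝ :=
  (y / u) ^ k * Real.exp (-(y / u)) * (Real.exp (-u) * u ^ (β - 1))

/-- The Bessel moment `∫₀^∞ (y/u)ᵏ·e^{−u−y/u}·u^{β−1} du`; for `k = 0` and `y = z²/4` it is
`2·K̃_{−β}(z)`. -/
def besselMoment (β : ℝ) (k : ℕ) (y : ℝ) : ℝ :=
  ∫ u in Ioi (0 : ℝ), besselIntegrand β k y u

lemma pow_mul_exp_neg_le {w : ℝ} (hw : 0 ≤ w) (k : ℕ) : w ^ k * Real.exp (-w) ≤ k ! := by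
  have h := Real.pow_div_factorial_le_exp w hw k
  have hf := Nat.cast_pos (α := ℝ).2 k.factorial_pos
  rw [div_le_iff₀ hf] at h
  rw [Real.exp_neg, mul_inv_le_iff₀ (Real.exp_pos _)]
  linarith

lemma besselIntegrand_nonneg (β : ℝ) (k : ℕ) {y u : ℝ} (hy : 0 ≤ y) (hu : 0 < u) :
    0 ≤ besselIntegrand β k y u := by
  rw [besselIntegrand]; positivity

lemma besselIntegrand_le_gamma (β : ℝ) (k : ℕ) {y u : ℝ} (hy : 0 ≤ y) (hu : 0 < u) :
    besselIntegrand β k y u ≤ k ! * (Real.exp (-u) * u ^ (β - 1)) := by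
  rw [besselIntegrand]
  exact mul_le_mul_of_nonneg_right (pow_mul_exp_neg_le (by positivity) k) (by positivity)

lemma besselIntegrand_le_gamma_shift (β : ℝ) (k : ℕ) {y u : ℝ} (hy : 0 < y) (hu : 0 < u) :
    besselIntegrand β k y u ≤ (k + 1)! / y * (Real.exp (-u) * u ^ (β + 1 - 1)) := by
  have h := besselIntegrand_le_gamma β (k + 1) hy.le hu
  have e : besselIntegrand β (k + 1) y u = y / u * besselIntegrand β k y u := by
    simp only [besselIntegrand, pow_succ]; ring
  rw [e] at h
  rw [add_sub_right_comm, Real.rpow_add_one hu.ne']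
  calc besselIntegrand β k y u = u / y * (y / u * besselIntegrand β k y u) := by field_simp
    _ ≤ u / y * ((k + 1)! * (Real.exp (-u) * u ^ (β - 1))) := by gcongr
    _ = _ := by ring

lemma measurable_besselIntegrand (β : ℝ) (k : ℕ) (y : ℝ) :
    Measurable (besselIntegrand β k y) := by
  unfold besselIntegrand; fun_prop

lemma integrableOn_besselIntegrand {β : ℝ} (hβ : 0 ≤ β) (k : ℕ) {y : ℝ} (hy : 0 < y) :
    IntegrableOn (besselIntegrand β k y) (Ioi 0) := by
  refine Integrable.mono'
    ((Real.GammaIntegral_convergent (by linarith : 0 < β + 1)).const_mul ((k + 1)! / y))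
    (measurable_besselIntegrand β k y).aestronglyMeasurable ?_
  filter_upwards [ae_restrict_mem measurableSet_Ioi] with u hu
  rw [Real.norm_of_nonneg (besselIntegrand_nonneg β k hy.le hu)]
  exact besselIntegrand_le_gamma_shift β k hy hu

lemma hasDerivAt_besselIntegrand (β : ℝ) (k : ℕ) {y u : ℝ} (hy : 0 < y) (hu : 0 < u) :
    HasDerivAt (fun s => besselIntegrand β k s u)
      ((k * besselIntegrand β k y u - besselIntegrand β (k + 1) y u) / y) y := by
  have h1 : HasDerivAt (fun s : ℝ => s / u) (1 / u) y := (hasDerivAt_id y).div_const u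
  have h := ((h1.fun_pow k).fun_mul h1.fun_neg.exp).mul_const (Real.exp (-u) * u ^ (β - 1))
  refine h.congr_deriv ?_
  simp only [besselIntegrand]
  rcases k with _ | k
  · simp; field_simp
  · simp only [Nat.add_sub_cancel, pow_succ]
    field_simp
    ring

lemma hasDerivAt_besselMoment {β : ℝ} (hβ : 0 ≤ β) (k : ℕ) {y : ℝ} (hy : 0 < y) :
    HasDerivAt (besselMoment β k)
      ((k * besselMoment β k y - besselMoment β (k + 1) y) / y) y := by
  set C : ℝ := (k * ((k + 1)! / (y / 2)) + (k + 1 + 1)! / (y / 2)) / (y / 2)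
  have h := (hasDerivAt_integral_of_dominated_loc_of_deriv_le
    (μ := volume.restrict (Ioi (0 : ℝ))) (F := besselIntegrand β k)
    (F' := fun s u => (k * besselIntegrand β k s u - besselIntegrand β (k + 1) s u) / s)
    (bound := fun u => C * (Real.exp (-u) * u ^ (β + 1 - 1)))
    (Ioi_mem_nhds (show y / 2 < y by linarith))
    (Eventually.of_forall fun s => (measurable_besselIntegrand β k s).aestronglyMeasurable)
    (integrableOn_besselIntegrand hβ k hy)
    ((((measurable_besselIntegrand β k y).const_mul _).sub
      (measurable_besselIntegrand β (k + 1) y)).div_const _).aestronglyMeasurable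
    ?_ ((Real.GammaIntegral_convergent (by linarith : 0 < β + 1)).const_mul C) ?_).2
  · refine h.congr_deriv ?_
    rw [integral_div, integral_sub ((integrableOn_besselIntegrand hβ k hy).const_mul _)
      (integrableOn_besselIntegrand hβ (k + 1) hy), integral_const_mul]
    rfl
  · filter_upwards [ae_restrict_mem measurableSet_Ioi] with u hu s hs
    have hu : 0 < u := hu
    have hs : y / 2 < s := hs
    have hs0 : 0 < s := by linarith
    have hb0 := besselIntegrand_nonneg β k hs0.le hu
    have hb1 := besselIntegrand_nonneg β (k + 1) hs0.le hu
    have hle0 := besselIntegrand_le_gamma_shift β k hs0 hu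
    have hle1 := besselIntegrand_le_gamma_shift β (k + 1) hs0 hu
    have hg : 0 ≤ Real.exp (-u) * u ^ (β + 1 - 1) := by positivity
    rw [norm_div, Real.norm_of_nonneg hs0.le]
    calc ‖k * besselIntegrand β k s u - besselIntegrand β (k + 1) s u‖ / s
        ≤ (k * besselIntegrand β k s u + besselIntegrand β (k + 1) s u) / s := by
          gcongr
          rw [Real.norm_eq_abs, abs_le]
          have : 0 ≤ k * besselIntegrand β k s u := by positivity
          constructor <;> linarith
      _ ≤ (k * ((k + 1)! / s * (Real.exp (-u) * u ^ (β + 1 - 1)))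
          + (k + 1 + 1)! / s * (Real.exp (-u) * u ^ (β + 1 - 1))) / s := by gcongr
      _ ≤ (k * ((k + 1)! / (y / 2) * (Real.exp (-u) * u ^ (β + 1 - 1)))
          + (k + 1 + 1)! / (y / 2) * (Real.exp (-u) * u ^ (β + 1 - 1))) / (y / 2) := by gcongr
      _ = C * (Real.exp (-u) * u ^ (β + 1 - 1)) := by ring
  · filter_upwards [ae_restrict_mem measurableSet_Ioi] with u hu s hs
    have hs : y / 2 < s := hs
    exact hasDerivAt_besselIntegrand β k (by linarith) hu

lemma tendsto_besselMoment {β : ℝ} (hβ : 0 < β) (k : ℕ) :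
    Tendsto (besselMoment β k) (𝓝[>] 0) (𝓝 (if k = 0 then Real.Gamma β else 0)) := by
  have hlim : (if k = 0 then Real.Gamma β else 0) =
      ∫ u in Ioi (0 : ℝ), besselIntegrand β k 0 u := by
    split_ifs with h
    · rw [Real.Gamma_eq_integral hβ]
      simp [besselIntegrand, h]
    · simp [besselIntegrand, h]
  rw [hlim]
  refine tendsto_integral_filter_of_dominated_convergence
    (fun u => k ! * (Real.exp (-u) * u ^ (β - 1)))
    (Eventually.of_forall fun y => (measurable_besselIntegrand β k y).aestronglyMeasurable) ?_
    ((Real.GammaIntegral_convergent hβ).const_mul _) ?_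
  · filter_upwards [self_mem_nhdsWithin] with y hy
    filter_upwards [ae_restrict_mem measurableSet_Ioi] with u hu
    have hy : 0 < y := hy
    rw [Real.norm_of_nonneg (besselIntegrand_nonneg β k hy.le hu)]
    exact besselIntegrand_le_gamma β k hy.le hu
  · filter_upwards with u
    have hc : Continuous fun y => besselIntegrand β k y u := by
      unfold besselIntegrand; fun_prop
    exact (hc.tendsto 0).mono_left nhdsWithin_le_nhds

lemma besselMoment_nonneg (β : ℝ) (k : ℕ) {y : ℝ} (hy : 0 < y) : 0 ≤ besselMoment β k y :=
  setIntegral_nonneg measurableSet_Ioi fun _ hu => besselIntegrand_nonneg β k hy.le hu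

lemma besselMoment_zero_succ_le (k : ℕ) {y : ℝ} (hy : 0 < y) :
    besselMoment 0 (k + 1) y ≤ Real.Gamma (k + 1) := by
  have hint : IntegrableOn (fun w : ℝ => y ^ (k + 1) * (w ^ ((k + 1 : ℝ) - 1) *
      Real.exp (-(y * w)))) (Ioi 0) := by
    refine (Integrable.of_integral_ne_zero ?_).const_mul _
    rw [Real.integral_rpow_mul_exp_neg_mul_Ioi (by positivity) hy]
    have := Real.Gamma_pos_of_pos (show (0 : ℝ) < k + 1 by positivity)
    positivity
  have hval : ∫ w in Ioi (0 : ℝ), y ^ (k + 1) * (w ^ ((k + 1 : ℝ) - 1) * Real.exp (-(y * w)))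
      = Real.Gamma (k + 1) := by
    rw [integral_const_mul, Real.integral_rpow_mul_exp_neg_mul_Ioi (by positivity) hy]
    rw [show ((k : ℝ) + 1) = ((k + 1 : ℕ) : ℝ) by push_cast; rfl, Real.rpow_natCast,
      ← mul_assoc, ← mul_pow, mul_one_div_cancel hy.ne', one_pow, one_mul]
  rw [besselMoment, ← integral_comp_rpow_Ioi _ (show (-1 : ℝ) ≠ 0 by norm_num), ← hval]
  refine integral_mono_of_nonneg ?_ hint ?_
  · filter_upwards [ae_restrict_mem measurableSet_Ioi] with w hw
    have hw : 0 < w := hw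
    exact smul_nonneg (by positivity) (besselIntegrand_nonneg _ _ hy.le (by positivity))
  · filter_upwards [ae_restrict_mem measurableSet_Ioi] with w hw
    have hw : 0 < w := hw
    have hexp : Real.exp (-w⁻¹) ≤ 1 := Real.exp_le_one_iff.2 (by simp [hw.le])
    have h2 : w ^ ((-1 : ℝ) - 1) = (w ^ 2)⁻¹ := by
      rw [show (-1 : ℝ) - 1 = -((2 : ℕ) : ℝ) by norm_num, Real.rpow_neg hw.le, Real.rpow_natCast]
    simp only [besselIntegrand, smul_eq_mul, Real.rpow_neg_one, h2, abs_neg, abs_one, one_mul,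
      zero_sub, inv_inv, div_inv_eq_mul, add_sub_cancel_right, Real.rpow_natCast]
    calc (w ^ 2)⁻¹ * ((y * w) ^ (k + 1) * Real.exp (-(y * w)) * (Real.exp (-w⁻¹) * w))
        ≤ (w ^ 2)⁻¹ * ((y * w) ^ (k + 1) * Real.exp (-(y * w)) * (1 * w)) := by gcongr
      _ = y ^ (k + 1) * (w ^ k * Real.exp (-(y * w))) := by rw [mul_pow]; field_simp; ring

/-! ### The `K`-Bessel function as a Bessel moment -/

lemma tildeK_neg {α z : ℝ} (hz : 0 < z) : tildeK α z = (z / 2) ^ (-(2 * α)) * tildeK (-α) z := by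
  have h : besselK (-α) z = besselK α z := by
    simp only [besselK, neg_mul, Real.cosh_neg]
  rw [tildeK, tildeK, h, ← mul_assoc, ← Real.rpow_add (by positivity)]
  ring_nf

lemma integral_Ioi_mul_cosh {g : ℝ → ℝ} (hg : ∀ s, g (-s) = g s) {a : ℝ}
    (hint : Integrable fun s => g s * Real.exp (a * s)) :
    ∫ s in Ioi (0 : ℝ), g s * Real.cosh (a * s) = (∫ s, g s * Real.exp (a * s)) / 2 := by
  have hint' : Integrable fun s => g s * Real.exp (-(a * s)) := by
    simpa [hg] using hint.comp_neg
  have hneg : ∫ s, g s * Real.exp (-(a * s)) = ∫ s, g s * Real.exp (a * s) := by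
    rw [← integral_neg_eq_self]; simp [hg]
  have hsum : ∫ s, g s * Real.cosh (a * s) = ∫ s, g s * Real.exp (a * s) := by
    have : (fun s => g s * Real.cosh (a * s)) = fun s =>
        (g s * Real.exp (a * s) + g s * Real.exp (-(a * s))) / 2 := by
      funext s; rw [Real.cosh_eq]; ring
    rw [this, integral_div, integral_add hint hint', hneg]; ring
  have habs : ∀ s, g |s| * Real.cosh (a * |s|) = g s * Real.cosh (a * s) := fun s => by
    rcases abs_choice s with h | h <;> rw [h]
    rw [hg, mul_neg, Real.cosh_neg]
  have h := integral_comp_abs (f := fun s => g s * Real.cosh (a * s))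
  simp only [habs] at h
  rw [← hsum, h]
  ring

lemma tildeK_neg_eq_besselMoment {β z : ℝ} (hβ : 0 ≤ β) (hz : 0 < z) :
    tildeK (-β) z = besselMoment β 0 (z ^ 2 / 4) / 2 := by
  have hderiv : ∀ s ∈ (univ : Set ℝ), HasDerivWithinAt (fun s => z / 2 * Real.exp s)
      (z / 2 * Real.exp s) univ s := fun s _ =>
    ((Real.hasDerivAt_exp s).const_mul _).hasDerivWithinAt
  have hinj : InjOn (fun s => z / 2 * Real.exp s) univ := fun s _ t _ h =>
    Real.exp_injective (mul_left_cancel₀ (by positivity) h)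
  have himage : (fun s => z / 2 * Real.exp s) '' univ = Ioi 0 := by
    ext u
    simp only [image_univ, mem_range, mem_Ioi]
    refine ⟨?_, fun hu => ⟨Real.log (u / (z / 2)), ?_⟩⟩
    · rintro ⟨s, rfl⟩; positivity
    · rw [Real.exp_log (by positivity)]; field_simp
  have hpull : ∀ s, |z / 2 * Real.exp s| •
      besselIntegrand β 0 (z ^ 2 / 4) (z / 2 * Real.exp s)
      = (z / 2) ^ β * (Real.exp (-z * Real.cosh s) * Real.exp (β * s)) := fun s => by
    have hpos : 0 < z / 2 * Real.exp s := by positivity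
    have hinv : z ^ 2 / 4 / (z / 2 * Real.exp s) = z / 2 * Real.exp (-s) := by
      rw [Real.exp_neg]; field_simp; norm_num
    rw [besselIntegrand, hinv, abs_of_pos hpos, Real.rpow_sub_one hpos.ne',
      Real.mul_rpow (by positivity) (Real.exp_pos s).le, ← Real.exp_mul, Real.cosh_eq,
      show -z * ((Real.exp s + Real.exp (-s)) / 2)
        = -(z / 2 * Real.exp (-s)) + -(z / 2 * Real.exp s) by ring, Real.exp_add, mul_comm s β,
      smul_eq_mul, pow_zero]
    field_simp
  have hy : 0 < z ^ 2 / 4 := by positivity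
  have hI := integrableOn_besselIntegrand hβ 0 hy
  rw [← himage, integrableOn_image_iff_integrableOn_abs_deriv_smul MeasurableSet.univ hderiv hinj,
    integrableOn_univ] at hI
  simp only [hpull] at hI
  have hc : 0 < (z / 2) ^ β := by positivity
  have hI' : Integrable fun s => Real.exp (-z * Real.cosh s) * Real.exp (β * s) :=
    (integrable_const_mul_iff (IsUnit.mk0 _ hc.ne') _).1 hI
  rw [besselMoment, ← himage, integral_image_eq_integral_abs_deriv_smul MeasurableSet.univ hderiv
    hinj, setIntegral_univ]
  simp only [hpull]
  rw [integral_const_mul, tildeK, neg_neg, mul_div_assoc, ← integral_Ioi_mul_cosh (by simp) hI',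
    besselK]
  simp only [neg_mul, Real.cosh_neg]

lemma tendsto_neg_log_half : Tendsto (fun z : ℝ => -Real.log (z / 2)) (𝓝[>] 0) atTop := by
  refine tendsto_neg_atBot_atTop.comp (Real.tendsto_log_nhdsGT_zero.comp ?_)
  refine tendsto_nhdsWithin_iff.2 ⟨?_, ?_⟩
  · have : Continuous fun z : ℝ => z / 2 := by fun_prop
    simpa using (this.tendsto 0).mono_left nhdsWithin_le_nhds
  · filter_upwards [self_mem_nhdsWithin] with z hz
    exact half_pos (mem_Ioi.1 hz)

lemma tendsto_besselK_zero_div_log :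
    Tendsto (fun z => besselK 0 z / -Real.log (z / 2)) (𝓝[>] 0) (𝓝 1) := by
  have hL := tendsto_neg_log_half
  have hscale : (fun z => besselK 0 z / -Real.log (z / 2)) =ᶠ[𝓝[>] 0] fun z =>
      ∫ v in Ioi (0 : ℝ), Real.exp (-z * Real.cosh (-Real.log (z / 2) * v)) := by
    filter_upwards [hL.eventually_gt_atTop 0] with z hLz
    rw [integral_comp_mul_left_Ioi (fun s => Real.exp (-z * Real.cosh s)) 0 hLz]
    simp [besselK, div_eq_inv_mul]
  have hone : ∫ v in Ioi (0 : ℝ), (Iio (1 : ℝ)).indicator (fun _ => (1 : ℝ)) v = 1 := by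
    rw [integral_indicator measurableSet_Iio, Measure.restrict_restrict measurableSet_Iio,
      inter_comm, Ioi_inter_Iio]
    simp
  refine Tendsto.congr' hscale.symm ?_
  rw [← hone]
  -- `z·cosh (L·v)` lies between `exp (L·(v-1))` and twice that, where `L = -log (z/2)`.
  have hbound : ∀ z : ℝ, 0 < z → ∀ v : ℝ,
      Real.exp (-Real.log (z / 2) * (v - 1)) ≤ z * Real.cosh (-Real.log (z / 2) * v) := by
    intro z hz v
    rw [show -Real.log (z / 2) * (v - 1) = Real.log (z / 2) + -Real.log (z / 2) * v by ring,
      Real.exp_add, Real.exp_log (by positivity), Real.cosh_eq]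
    have := Real.exp_pos (-(-Real.log (z / 2) * v))
    nlinarith
  have hbound' : ∀ z : ℝ, 0 < z → 0 ≤ -Real.log (z / 2) → ∀ v : ℝ, 0 < v →
      z * Real.cosh (-Real.log (z / 2) * v) ≤ 2 * Real.exp (-Real.log (z / 2) * (v - 1)) := by
    intro z hz hLz v hv
    rw [show -Real.log (z / 2) * (v - 1) = Real.log (z / 2) + -Real.log (z / 2) * v by ring,
      Real.exp_add, Real.exp_log (by positivity), Real.cosh_eq]
    have : Real.exp (-(-Real.log (z / 2) * v)) ≤ Real.exp (-Real.log (z / 2) * v) :=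
      Real.exp_le_exp.2 (by nlinarith)
    nlinarith
  refine tendsto_integral_filter_of_dominated_convergence (fun v => Real.exp 1 * Real.exp (-v))
    (Eventually.of_forall fun z => by fun_prop) ?_
    ((integrableOn_exp_neg_Ioi 0).const_mul _) ?_
  · filter_upwards [hL.eventually_ge_atTop 1, self_mem_nhdsWithin] with z hLz hz
    filter_upwards [ae_restrict_mem measurableSet_Ioi] with v hv
    have hz : 0 < z := hz
    have hv : 0 < v := hv
    rw [Real.norm_of_nonneg (Real.exp_pos _).le, ← Real.exp_add]
    refine Real.exp_le_exp.2 ?_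
    have hcosh : 0 < z * Real.cosh (-Real.log (z / 2) * v) := mul_pos hz (Real.cosh_pos _)
    rcases le_total v 1 with h | h
    · linarith
    · have h1 := hbound z hz v
      have h2 := Real.add_one_le_exp (-Real.log (z / 2) * (v - 1))
      nlinarith
  · filter_upwards [ae_restrict_mem measurableSet_Ioi,
      ae_restrict_of_ae (Measure.ae_ne volume (1 : ℝ))] with v hv hv1
    have hv : 0 < v := hv
    rcases lt_or_gt_of_ne hv1 with h | h
    · have hexp : Tendsto (fun z => 2 * Real.exp (-Real.log (z / 2) * (v - 1))) (𝓝[>] 0)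
          (𝓝 0) := by
        simpa using (Real.tendsto_exp_atBot.comp
          (hL.atTop_mul_const_of_neg (sub_neg.2 h))).const_mul 2
      have hz : Tendsto (fun z => z * Real.cosh (-Real.log (z / 2) * v)) (𝓝[>] 0) (𝓝 0) := by
        refine tendsto_of_tendsto_of_tendsto_of_le_of_le' tendsto_const_nhds hexp ?_ ?_
        · filter_upwards [self_mem_nhdsWithin] with z hz
          exact (mul_pos hz (Real.cosh_pos _)).le
        · filter_upwards [self_mem_nhdsWithin, hL.eventually_ge_atTop 0] with z hz hLz
          exact hbound' z hz hLz v hv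
      simpa [h, Function.comp_def] using (Real.continuous_exp.tendsto _).comp hz.neg
    · have hexp : Tendsto (fun z => Real.exp (-Real.log (z / 2) * (v - 1))) (𝓝[>] 0) atTop :=
        Real.tendsto_exp_atTop.comp (hL.atTop_mul_const (sub_pos.2 h))
      have hz : Tendsto (fun z => z * Real.cosh (-Real.log (z / 2) * v)) (𝓝[>] 0) atTop := by
        refine tendsto_atTop_mono' _ ?_ hexp
        filter_upwards [self_mem_nhdsWithin] with z hz
        exact hbound z hz v
      simpa [h.le, Function.comp_def, -Real.tendsto_exp_comp_nhds_zero] using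
        Real.tendsto_exp_neg_atTop_nhds_zero.comp hz


/-! ### Derivatives of Bessel moments along the generating function -/

/-- The Bessel moment at `y = z²/4` for `z = x/(1-t)`. -/
def besselMomentAlong (β : ℝ) (k : ℕ) (x t : ℝ) : ℝ :=
  besselMoment β k ((x / (1 - t)) ^ 2 / 4)

lemma hasDerivAt_besselMomentAlong {β : ℝ} (hβ : 0 ≤ β) (k : ℕ) {x t : ℝ} (hx : 0 < x)
    (ht : t < 1) :
    HasDerivAt (besselMomentAlong β k x)
      (2 / (1 - t) * (k * besselMomentAlong β k x t - besselMomentAlong β (k + 1) x t)) t := by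
  have hpos : 0 < 1 - t := by linarith
  have hz : HasDerivAt (fun t : ℝ => (x / (1 - t)) ^ 2 / 4)
      (2 / (1 - t) * ((x / (1 - t)) ^ 2 / 4)) t := by
    have h := ((((hasDerivAt_id t).const_sub 1).fun_inv hpos.ne').const_mul x).fun_pow 2
      |>.div_const 4
    refine (h.congr_deriv ?_).congr_of_eventuallyEq (.of_eq ?_)
    · simp only [id]; field_simp; norm_num; field_simp
    · funext s; simp [div_eq_mul_inv]
  refine ((hasDerivAt_besselMoment hβ k (by positivity)).comp t hz).congr_deriv ?_
  simp only [besselMomentAlong]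
  field_simp

lemma contDiffOn_two_div_one_sub : ContDiffOn ℝ ∞ (fun t : ℝ => 2 / (1 - t)) (Iio 1) :=
  contDiffOn_const.div (contDiff_const.sub contDiff_id).contDiffOn
    fun _ ht => (sub_pos.2 (mem_Iio.1 ht)).ne'

lemma contDiffOn_besselMomentAlong {β : ℝ} (hβ : 0 ≤ β) (k : ℕ) {x : ℝ} (hx : 0 < x) :
    ContDiffOn ℝ ∞ (besselMomentAlong β k x) (Iio 1) := by
  refine contDiffOn_infty.2 fun n => ?_
  induction n generalizing k with
  | zero =>
    exact contDiffOn_zero.2 fun t ht =>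
      (hasDerivAt_besselMomentAlong hβ k hx ht).continuousAt.continuousWithinAt
  | succ n ih =>
    push_cast
    rw [contDiffOn_succ_iff_deriv_of_isOpen isOpen_Iio]
    refine ⟨fun t ht => (hasDerivAt_besselMomentAlong hβ k hx
      ht).differentiableAt.differentiableWithinAt, by simp, ?_⟩
    refine ContDiffOn.congr ?_ fun t ht => (hasDerivAt_besselMomentAlong hβ k hx ht).deriv
    exact (contDiffOn_two_div_one_sub.of_le (by exact_mod_cast le_top)).mul
      ((contDiffOn_const.mul (ih k)).sub (ih (k + 1)))

lemma tendsto_iteratedDeriv_besselMomentAlong {β : ℝ} (hβ : 0 ≤ β) {c : ℝ} {L : ℝ → ℝ}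
    (hL : ∀ k : ℕ, Tendsto (fun x => L x * besselMoment β k (x ^ 2 / 4)) (𝓝[>] 0)
      (𝓝 (if k = 0 then c else 0))) (n k : ℕ) :
    Tendsto (fun x => L x * iteratedDeriv n (besselMomentAlong β k x) 0) (𝓝[>] 0)
      (𝓝 (if n = 0 ∧ k = 0 then c else 0)) := by
  induction n using Nat.strong_induction_on generalizing k with
  | _ n ih =>
  rcases n with _ | n
  · simpa [besselMomentAlong] using hL k
  have hzero : ∀ m, (k : ℝ) * (if m = 0 ∧ k = 0 then c else 0)
      - (if m = 0 ∧ k + 1 = 0 then c else 0) = 0 := fun m => by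
    rcases k with _ | k <;> simp
  have hsum : Tendsto (fun x => ∑ i ∈ Finset.range (n + 1),
      n.choose i * iteratedDeriv i (fun t : ℝ => 2 / (1 - t)) 0 *
        (k * (L x * iteratedDeriv (n - i) (besselMomentAlong β k x) 0)
          - L x * iteratedDeriv (n - i) (besselMomentAlong β (k + 1) x) 0)) (𝓝[>] 0) (𝓝 0) := by
    have := tendsto_finsetSum (Finset.range (n + 1)) fun i _ =>
      (((ih (n - i) (by omega) k).const_mul (k : ℝ)).sub (ih (n - i) (by omega) (k + 1))).const_mul
        (n.choose i * iteratedDeriv i (fun t : ℝ => 2 / (1 - t)) 0)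
    simpa only [hzero, mul_zero, Finset.sum_const_zero] using this
  simp only [Nat.add_eq_zero_iff, one_ne_zero, and_false, false_and, if_false]
  refine hsum.congr' ?_
  filter_upwards [self_mem_nhdsWithin] with x hx
  have hx : 0 < x := hx
  have hnhds : Iio (1 : ℝ) ∈ 𝓝 0 := Iio_mem_nhds one_pos
  have hK : ∀ (k m : ℕ), ContDiffAt ℝ m (besselMomentAlong β k x) 0 := fun k m =>
    ((contDiffOn_besselMomentAlong hβ k hx).contDiffAt hnhds).of_le (by exact_mod_cast le_top)
  have hderiv : deriv (besselMomentAlong β k x) =ᶠ[𝓝 0] (fun t : ℝ => 2 / (1 - t)) *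
      ((k : ℝ) • besselMomentAlong β k x - besselMomentAlong β (k + 1) x) := by
    filter_upwards [hnhds] with t ht using (hasDerivAt_besselMomentAlong hβ k hx ht).deriv
  have hR : ContDiffAt ℝ n
      ((k : ℝ) • besselMomentAlong β k x - besselMomentAlong β (k + 1) x) 0 :=
    ((hK k n).const_smul (k : ℝ)).sub (hK (k + 1) n)
  have hkS : ∀ m : ℕ, ContDiffAt ℝ m ((k : ℝ) • besselMomentAlong β k x) 0 := fun m =>
    (hK k m).const_smul (k : ℝ)
  rw [iteratedDeriv_succ', hderiv.iteratedDeriv_eq, iteratedDeriv_mul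
    ((contDiffOn_two_div_one_sub.contDiffAt hnhds).of_le (by exact_mod_cast le_top))
    hR, Finset.mul_sum]
  refine Finset.sum_congr rfl fun i _ => ?_
  rw [iteratedDeriv_sub (hkS _) (hK (k + 1) _),
    iteratedDeriv_const_smul (hK k _), smul_eq_mul]
  ring

lemma tendsto_besselMoment_sq {β : ℝ} (hβ : 0 < β) (k : ℕ) :
    Tendsto (fun x : ℝ => 1 * besselMoment β k (x ^ 2 / 4)) (𝓝[>] 0)
      (𝓝 (if k = 0 then Real.Gamma β else 0)) := by
  simp only [one_mul]
  refine (tendsto_besselMoment hβ k).comp (tendsto_nhdsWithin_iff.2 ⟨?_, ?_⟩)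
  · have : Continuous fun x : ℝ => x ^ 2 / 4 := by fun_prop
    simpa using (this.tendsto 0).mono_left nhdsWithin_le_nhds
  · filter_upwards [self_mem_nhdsWithin] with x hx
    have hx : 0 < x := hx
    exact mem_Ioi.2 (by positivity)

lemma tendsto_besselMoment_zero_sq_div_log (k : ℕ) :
    Tendsto (fun x : ℝ => (-Real.log (x / 2))⁻¹ * besselMoment 0 k (x ^ 2 / 4)) (𝓝[>] 0)
      (𝓝 (if k = 0 then 2 else 0)) := by
  rcases k with _ | k
  · have h := tendsto_besselK_zero_div_log.const_mul 2
    simp only [mul_one, if_true] at h ⊢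
    refine h.congr' ?_
    filter_upwards [self_mem_nhdsWithin] with x hx
    have hK := tildeK_neg_eq_besselMoment le_rfl (mem_Ioi.1 hx)
    simp only [tildeK, neg_zero, Real.rpow_zero, one_mul] at hK
    rw [hK, div_eq_inv_mul]
    ring
  · simp only [Nat.add_eq_zero_iff, one_ne_zero, and_false, if_false]
    have hinv := tendsto_inv_atTop_zero.comp tendsto_neg_log_half
    have hbd := hinv.mul_const (Real.Gamma (k + 1))
    rw [zero_mul] at hbd
    refine tendsto_of_tendsto_of_tendsto_of_le_of_le' tendsto_const_nhds hbd ?_ ?_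
    all_goals
      filter_upwards [self_mem_nhdsWithin, tendsto_neg_log_half.eventually_ge_atTop 0]
        with x hx hlog
      have hx : 0 < x := hx
      have hy : 0 < x ^ 2 / 4 := by positivity
    · exact mul_nonneg (inv_nonneg.2 hlog) (besselMoment_nonneg _ _ hy)
    · exact mul_le_mul_of_nonneg_left (besselMoment_zero_succ_le k hy) (inv_nonneg.2 hlog)

/-! ### Asymptotics of `Λ₂ⱼ` -/

lemma tendsto_mul_Lambda₂ (μ : ℝ) {β : ℝ} (hβ : 0 ≤ β) {c : ℝ} {L : ℝ → ℝ}
    (hL : ∀ k : ℕ, Tendsto (fun x => L x * besselMoment β k (x ^ 2 / 4)) (𝓝[>] 0)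
      (𝓝 (if k = 0 then c else 0))) (j : ℕ) :
    Tendsto (fun x => L x * Lambda₂ μ (-(2 * β)) j x) (𝓝[>] 0)
      (𝓝 (poch ((μ - 2 * β + 2) / 2) j * c / (2 * (j ! : ℝ) * Real.Gamma ((μ + 2) / 2)))) := by
  set b := (μ - 2 * β + 2) / 2 with hb
  set H : ℝ → ℝ → ℝ := fun x t => (1 - t) ^ (-b) * tildeI (μ / 2) (t * x / (1 - t)) with hH
  have hHs : ContDiffOn ℝ ∞ (fun p : ℝ × ℝ => H p.1 p.2) (univ ×ˢ Iio 1) :=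
    contDiffOn_rpow_mul_tildeI (-b) (μ / 2)
  have hnhds : Iio (1 : ℝ) ∈ 𝓝 0 := Iio_mem_nhds one_pos
  have hsum : Tendsto (fun x => (∑ i ∈ Finset.range (j + 1), j.choose i *
      iteratedDeriv i (H x) 0 * (L x * iteratedDeriv (j - i) (besselMomentAlong β 0 x) 0)) /
        (2 * j !)) (𝓝[>] 0) (𝓝 ((∑ i ∈ Finset.range (j + 1), j.choose i *
      iteratedDeriv i (H 0) 0 * (if j - i = 0 ∧ 0 = 0 then c else 0)) / (2 * j !))) := by
    refine (tendsto_finsetSum _ fun i _ => ?_).div_const _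
    exact (((tendsto_iteratedDeriv_param isOpen_Iio hHs i 0 (t := 0) (by simp)).mono_left
      nhdsWithin_le_nhds).const_mul _).mul
      (tendsto_iteratedDeriv_besselMomentAlong hβ hL (j - i) 0)
  have hlim : (∑ i ∈ Finset.range (j + 1), j.choose i *
      iteratedDeriv i (H 0) 0 * (if j - i = 0 ∧ 0 = 0 then c else 0)) / (2 * j !)
      = poch b j * c / (2 * (j ! : ℝ) * Real.Gamma ((μ + 2) / 2)) := by
    have hH0 : H 0 = fun t => (1 - t) ^ (-b) * (1 / Real.Gamma ((μ + 2) / 2)) := by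
      funext t
      simp only [hH, mul_zero, zero_div, tildeI_zero, show μ / 2 + 1 = (μ + 2) / 2 by ring]
    rw [Finset.sum_range_succ, Finset.sum_eq_zero, hH0, iteratedDeriv_rpow_mul_const]
    · simp only [div_eq_mul_inv, mul_inv]
      simp
      ring
    · intro i hi
      rw [if_neg (by have := Finset.mem_range.1 hi; omega), mul_zero]
  rw [hlim] at hsum
  refine hsum.congr' ?_
  filter_upwards [self_mem_nhdsWithin] with x hx
  have hx : 0 < x := hx
  have hG : (fun t => genG₂ μ (-(2 * β)) t x) =ᶠ[𝓝 0]
      fun t => (H x * besselMomentAlong β 0 x) t / 2 := by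
    filter_upwards [hnhds] with t ht
    have hpos : 0 < 1 - t := sub_pos.2 ht
    rw [genG₂, show -(2 * β) / 2 = -β by ring, tildeK_neg_eq_besselMoment hβ (by positivity),
      show -(μ + -(2 * β) + 2) / 2 = -b by rw [hb]; ring]
    simp only [hH, besselMomentAlong, Pi.mul_apply]
    ring
  rw [Lambda₂, hG.iteratedDeriv_eq, iteratedDeriv_div_const, iteratedDeriv_mul
    (((contDiffOn_section hHs x).contDiffAt hnhds).of_le (by exact_mod_cast le_top))
    (((contDiffOn_besselMomentAlong hβ 0 hx).contDiffAt hnhds).of_le (by exact_mod_cast le_top)),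
    div_div, ← mul_div_assoc, Finset.mul_sum]
  congr 1
  exact Finset.sum_congr rfl fun i _ => by ring

lemma tendsto_Lambda₂_of_neg (μ : ℝ) {ν : ℝ} (hν : ν < 0) (j : ℕ) :
    Tendsto (fun x => Lambda₂ μ ν j x) (𝓝[>] (0 : ℝ))
      (𝓝 (poch ((μ + ν + 2) / 2) j * Real.Gamma (-ν / 2) /
        (2 * (j.factorial : ℝ) * Real.Gamma ((μ + 2) / 2)))) := by
  have hβ : 0 < -ν / 2 := by linarith
  have h := tendsto_mul_Lambda₂ μ hβ.le (tendsto_besselMoment_sq hβ) j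
  simpa only [one_mul, mul_div_cancel₀ (-ν) (two_ne_zero' ℝ), neg_neg, sub_neg_eq_add] using h

lemma tendsto_Lambda₂_zero_div_log (μ : ℝ) (j : ℕ) :
    Tendsto (fun x => Lambda₂ μ 0 j x / (-Real.log (x / 2))) (𝓝[>] (0 : ℝ))
      (𝓝 (poch ((μ + 2) / 2) j / ((j.factorial : ℝ) * Real.Gamma ((μ + 2) / 2)))) := by
  have h := tendsto_mul_Lambda₂ μ le_rfl tendsto_besselMoment_zero_sq_div_log j
  simp only [mul_zero, neg_zero, sub_zero] at h
  simp only [div_eq_inv_mul _ (-Real.log _)]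
  convert h using 2
  rw [mul_assoc, mul_comm _ (2 : ℝ), mul_div_mul_left _ _ two_ne_zero]

lemma rpow_mul_Lambda₂ (μ ν : ℝ) (j : ℕ) {x : ℝ} (hx : 0 < x) :
    x ^ ν * Lambda₂ μ ν j x = 2 ^ ν * Lambda₂ μ (-ν) j x := by
  have hG : (fun t => genG₂ μ ν t x) =ᶠ[𝓝 0] fun t => (x / 2) ^ (-ν) * genG₂ μ (-ν) t x := by
    filter_upwards [Iio_mem_nhds one_pos] with t ht
    have hpos : 0 < 1 - t := sub_pos.2 ht
    rw [genG₂, genG₂, tildeK_neg (by positivity : 0 < x / (1 - t)),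
      show -(2 * (ν / 2)) = -ν by ring, show -(ν / 2) = -ν / 2 by ring,
      show x / (1 - t) / 2 = x / 2 * (1 - t)⁻¹ by ring, Real.mul_rpow (by positivity)
        (by positivity), Real.inv_rpow hpos.le, ← Real.rpow_neg hpos.le, neg_neg,
      show -(μ + -ν + 2) / 2 = -(μ + ν + 2) / 2 + ν by ring, Real.rpow_add hpos]
    ring
  rw [Lambda₂, Lambda₂, hG.iteratedDeriv_eq, iteratedDeriv_const_mul_field,
    Real.div_rpow hx.le two_pos.le, Real.rpow_neg hx.le, Real.rpow_neg two_pos.le]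
  have := Real.rpow_pos_of_pos hx ν
  field_simp

lemma tendsto_rpow_mul_Lambda₂ (μ : ℝ) {ν : ℝ} (hν : 0 < ν) (j : ℕ) :
    Tendsto (fun x => x ^ ν * Lambda₂ μ ν j x) (𝓝[>] (0 : ℝ))
      (𝓝 (poch ((μ - ν + 2) / 2) j * 2 ^ (ν - 1) * Real.Gamma (ν / 2) /
        ((j.factorial : ℝ) * Real.Gamma ((μ + 2) / 2)))) := by
  have h := (tendsto_Lambda₂_of_neg μ (neg_lt_zero.2 hν) j).const_mul ((2 : ℝ) ^ ν)
  rw [neg_neg, ← sub_eq_add_neg] at h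
  have hval : poch ((μ - ν + 2) / 2) j * 2 ^ (ν - 1) * Real.Gamma (ν / 2) /
      ((j ! : ℝ) * Real.Gamma ((μ + 2) / 2)) =
      2 ^ ν * (poch ((μ - ν + 2) / 2) j * Real.Gamma (ν / 2) /
        (2 * (j ! : ℝ) * Real.Gamma ((μ + 2) / 2))) := by
    rw [Real.rpow_sub_one two_ne_zero]
    simp only [div_eq_mul_inv, mul_inv]
    ring
  rw [hval]
  refine h.congr' ?_
  filter_upwards [self_mem_nhdsWithin] with x hx using (rpow_mul_Lambda₂ μ ν j hx).symm


/-- Asymptotic behavior of `Λ_{1,j}^{μ,ν}` and `Λ_{2,j}^{μ,ν}` as `x → 0⁺`, for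
`μ ∉ {−1,−2,−3,…}`. -/
theorem statement7 (μ ν : ℝ) (hμ : ∀ n : ℕ, μ ≠ -((n : ℝ) + 1)) (j : ℕ) :
    Tendsto (fun x => Lambda₁ μ ν j x) (𝓝[>] (0 : ℝ))
      (𝓝 (poch ((μ + ν + 2) / 2) j /
        ((j.factorial : ℝ) * Real.Gamma ((μ + 2) / 2) * Real.Gamma ((ν + 2) / 2)))) ∧
    (0 < ν →
      Tendsto (fun x => x ^ ν * Lambda₂ μ ν j x) (𝓝[>] (0 : ℝ))
        (𝓝 (poch ((μ - ν + 2) / 2) j * 2 ^ (ν - 1) * Real.Gamma (ν / 2) /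
          ((j.factorial : ℝ) * Real.Gamma ((μ + 2) / 2))))) ∧
    (ν = 0 →
      Tendsto (fun x => Lambda₂ μ ν j x / (-Real.log (x / 2))) (𝓝[>] (0 : ℝ))
        (𝓝 (poch ((μ + 2) / 2) j / ((j.factorial : ℝ) * Real.Gamma ((μ + 2) / 2))))) ∧
    (ν < 0 →
      Tendsto (fun x => Lambda₂ μ ν j x) (𝓝[>] (0 : ℝ))
        (𝓝 (poch ((μ + ν + 2) / 2) j * Real.Gamma (-ν / 2) /
          (2 * (j.factorial : ℝ) * Real.Gamma ((μ + 2) / 2))))) := by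
  refine ⟨tendsto_Lambda₁ μ ν j, fun hν => tendsto_rpow_mul_Lambda₂ μ hν j, ?_,
    fun hν => tendsto_Lambda₂_of_neg μ hν j⟩
  rintro rfl
  exact tendsto_Lambda₂_zero_div_log μ j
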